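/- Consider the CSTR bifurcation problem G(u,f,θ,ε,ℓ) = f·e^{−1/u}/(e^{−1/u} + f) + (εf + ℓ)(θ − u). Fix 0 < u < 1/2 and set f = e^{−1/u}(−1 − 4u)/(−2 + 4u), θ = u(1 + u)/(1 + 4u), ε = (4/27)(16u + 1/u² − 12), ℓ = e^{−1/u}(1 + 4u)³/(27u²). Then at this point G = 0, ∂G/∂u = 0, ∂G/∂f = 0, the determinant of the Hessian of G with respect to (u,f) equals 0, and ∂²G/∂u² ≠ 0; that is, the CSTR problem has an asymmetric cusp at this point. -/

import Mathlib

/-- The CSTR bifurcation problem: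
`G(u,f,θ,ε,ℓ) = f·e^{−1/u}/(e^{−1/u} + f) + (εf + ℓ)(θ − u)`. -/
noncomputable def G (u f th ep l : ℝ) : ℝ :=
  f * Real.exp (-1/u) / (Real.exp (-1/u) + f) + (ep*f + l) * (th - u)

/-- `∂G/∂u` -/
noncomputable def Gu (u f th ep l : ℝ) : ℝ := deriv (fun t => G t f th ep l) u
/-- `∂G/∂f` -/
noncomputable def Gf (u f th ep l : ℝ) : ℝ := deriv (fun t => G u t th ep l) f
/-- `∂²G/∂u²` -/
noncomputable def Guu (u f th ep l : ℝ) : ℝ := deriv (fun t => Gu t f th ep l) u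
/-- `∂²G/∂u∂f` -/
noncomputable def Guf (u f th ep l : ℝ) : ℝ := deriv (fun t => Gu u t th ep l) f
/-- `∂²G/∂f∂u` -/
noncomputable def Gfu (u f th ep l : ℝ) : ℝ := deriv (fun t => Gf t f th ep l) u
/-- `∂²G/∂f²` -/
noncomputable def Gff (u f th ep l : ℝ) : ℝ := deriv (fun t => Gf u t th ep l) f
/-- Determinant of the Hessian of `G` with respect to `(u,f)`. -/
noncomputable def detH (u f th ep l : ℝ) : ℝ :=
  Guu u f th ep l * Gff u f th ep l - Guf u f th ep l * Gfu u f th ep l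

theorem hasDerivAt_exp_neg_one_div {t : ℝ} (ht : t ≠ 0) :
    HasDerivAt (fun t : ℝ => Real.exp (-1/t)) (Real.exp (-1/t) / t^2) t := by
  have h := ((hasDerivAt_const t (-1 : ℝ)).div (hasDerivAt_id t) ht).exp
  refine h.congr_deriv ?_
  change Real.exp (-1/t) * ((0 * t - -1 * 1) / t^2) = _
  ring

theorem Gu_eq {t f : ℝ} (ht : t ≠ 0) (hf : 0 < f) (th ep l : ℝ) :
    Gu t f th ep l =
      f^2 * Real.exp (-1/t) / (t^2 * (Real.exp (-1/t) + f)^2) - (ep*f + l) := by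
  have hE := hasDerivAt_exp_neg_one_div ht
  have hpos : Real.exp (-1/t) + f ≠ 0 := by positivity
  have h := ((hE.const_mul f).div (hE.add_const f) hpos).add
    (((hasDerivAt_id t).const_sub th).const_mul (ep*f + l))
  refine (HasDerivAt.deriv h).trans ?_
  field_simp
  ring

theorem Gf_eq {f : ℝ} (hf : 0 < f) (t th ep l : ℝ) :
    Gf t f th ep l =
      Real.exp (-1/t)^2 / (Real.exp (-1/t) + f)^2 + ep * (th - t) := by
  have hpos : Real.exp (-1/t) + f ≠ 0 := by positivity
  have h := (((hasDerivAt_id f).mul_const (Real.exp (-1/t))).div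
    ((hasDerivAt_id f).const_add (Real.exp (-1/t))) hpos).add
    ((((hasDerivAt_id f).const_mul ep).add_const l).mul_const (th - t))
  refine (HasDerivAt.deriv h).trans ?_
  simp only [id]
  field_simp
  ring

theorem Guu_eq {t f : ℝ} (ht : t ≠ 0) (hf : 0 < f) (th ep l : ℝ) :
    Guu t f th ep l =
      f^2 * Real.exp (-1/t) * ((1 - 2*t) * (Real.exp (-1/t) + f) - 2 * Real.exp (-1/t)) /
        (t^4 * (Real.exp (-1/t) + f)^3) := by
  have hev : (fun t => Gu t f th ep l) =ᶠ[nhds t] fun t =>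
      f^2 * Real.exp (-1/t) / (t^2 * (Real.exp (-1/t) + f)^2) - (ep*f + l) := by
    filter_upwards [eventually_ne_nhds ht] with x hx using Gu_eq hx hf th ep l
  have hE := hasDerivAt_exp_neg_one_div ht
  have hpos : Real.exp (-1/t) + f ≠ 0 := by positivity
  have h := ((hE.const_mul (f^2)).div ((hasDerivAt_pow 2 t).mul ((hE.add_const f).pow 2))
    (mul_ne_zero (pow_ne_zero 2 ht) (pow_ne_zero 2 hpos))).sub_const (ep*f + l)
  refine hev.deriv_eq.trans ((HasDerivAt.deriv h).trans ?_)
  simp only [Pi.mul_apply, Pi.pow_apply]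
  field_simp
  ring

theorem Guf_eq {t f : ℝ} (ht : t ≠ 0) (hf : 0 < f) (th ep l : ℝ) :
    Guf t f th ep l =
      2 * f * Real.exp (-1/t)^2 / (t^2 * (Real.exp (-1/t) + f)^3) - ep := by
  have hev : (fun f => Gu t f th ep l) =ᶠ[nhds f] fun f =>
      f^2 * Real.exp (-1/t) / (t^2 * (Real.exp (-1/t) + f)^2) - (ep*f + l) := by
    filter_upwards [eventually_gt_nhds hf] with x hx using Gu_eq ht hx th ep l
  have hpos : Real.exp (-1/t) + f ≠ 0 := by positivity
  have h := (((hasDerivAt_pow 2 f).mul_const (Real.exp (-1/t))).div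
    ((((hasDerivAt_id f).const_add (Real.exp (-1/t))).pow 2).const_mul (t^2))
    (mul_ne_zero (pow_ne_zero 2 ht) (pow_ne_zero 2 hpos))).sub
    (((hasDerivAt_id f).const_mul ep).add_const l)
  refine hev.deriv_eq.trans ((HasDerivAt.deriv h).trans ?_)
  simp only [id, Pi.pow_apply]
  field_simp
  ring

theorem Gfu_eq {t f : ℝ} (ht : t ≠ 0) (hf : 0 < f) (th ep l : ℝ) :
    Gfu t f th ep l =
      2 * f * Real.exp (-1/t)^2 / (t^2 * (Real.exp (-1/t) + f)^3) - ep := by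
  have hfun : (fun t => Gf t f th ep l) = fun t =>
      Real.exp (-1/t)^2 / (Real.exp (-1/t) + f)^2 + ep * (th - t) :=
    funext fun x => Gf_eq hf x th ep l
  have hE := hasDerivAt_exp_neg_one_div ht
  have hpos : Real.exp (-1/t) + f ≠ 0 := by positivity
  have h := ((hE.pow 2).div ((hE.add_const f).pow 2) (pow_ne_zero 2 hpos)).add
    (((hasDerivAt_id t).const_sub th).const_mul ep)
  refine (congrArg (fun g => deriv g t) hfun).trans ((HasDerivAt.deriv h).trans ?_)
  simp only [Pi.pow_apply]
  field_simp
  ring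

theorem Gff_eq {f : ℝ} (hf : 0 < f) (t th ep l : ℝ) :
    Gff t f th ep l = -2 * Real.exp (-1/t)^2 / (Real.exp (-1/t) + f)^3 := by
  have hev : (fun f => Gf t f th ep l) =ᶠ[nhds f] fun f =>
      Real.exp (-1/t)^2 / (Real.exp (-1/t) + f)^2 + ep * (th - t) := by
    filter_upwards [eventually_gt_nhds hf] with x hx using Gf_eq hx t th ep l
  have hpos : Real.exp (-1/t) + f ≠ 0 := by positivity
  have h := ((hasDerivAt_const f (Real.exp (-1/t)^2)).div
    (((hasDerivAt_id f).const_add (Real.exp (-1/t))).pow 2) (pow_ne_zero 2 hpos)).add_const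
    (ep * (th - t))
  refine hev.deriv_eq.trans ((HasDerivAt.deriv h).trans ?_)
  simp only [id, Pi.pow_apply]
  field_simp
  ring

/-- For `0 < u < 1/2` the stated point is an asymmetric cusp of the CSTR problem. -/
theorem CSTR_asymmetric_cusp (u : ℝ) (hu0 : 0 < u) (hu1 : u < 1/2)
    (f th ep l : ℝ)
    (hf : f = Real.exp (-1/u) * (-1 - 4*u) / (-2 + 4*u))
    (hth : th = u * (1 + u) / (1 + 4*u))
    (hep : ep = (4/27) * (16*u + 1/u^2 - 12))
    (hl : l = Real.exp (-1/u) * (1 + 4*u)^3 / (27*u^2)) :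
    G u f th ep l = 0 ∧ Gu u f th ep l = 0 ∧ Gf u f th ep l = 0 ∧
    detH u f th ep l = 0 ∧ Guu u f th ep l ≠ 0 := by
  have hE : 0 < Real.exp (-1/u) := Real.exp_pos _
  have hu : u ≠ 0 := hu0.ne'
  have hv : 0 < 1 - 2*u := by linarith
  have hv_ne : 1 - u*2 ≠ 0 := by linarith
  have hw : 0 < 1 + 4*u := by linarith
  have hf' : f = Real.exp (-1/u) * (1 + 4*u) / (2 * (1 - 2*u)) := by
    rw [hf, div_eq_div_iff (by linarith) (by positivity)]
    ring
  have hfpos : 0 < f := by rw [hf']; positivity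
  have hsum : Real.exp (-1/u) + f = 3 * Real.exp (-1/u) / (2 * (1 - 2*u)) := by
    rw [hf']
    field_simp
    ring
  have hep' : ep = 4 * (1 - 2*u)^2 * (1 + 4*u) / (27 * u^2) := by
    rw [hep]
    field_simp
    ring
  have hlin : ep*f + l = Real.exp (-1/u) * (1 + 4*u)^2 / (9 * u^2) := by
    rw [hep', hf', hl]
    field_simp
    ring
  have hdiff : th - u = -3 * u^2 / (1 + 4*u) := by
    rw [hth]
    field_simp
    ring
  have hGuu : Guu u f th ep l =
      -(Real.exp (-1/u) * (1 + 4*u)^2 * (1 - 2*u) / (27 * u^4)) := by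
    rw [Guu_eq hu hfpos, hsum, hf']
    field_simp
    ring
  refine ⟨?_, ?_, ?_, ?_, ?_⟩
  · rw [G, hlin, hdiff, hsum, hf']
    field_simp
    ring
  · rw [Gu_eq hu hfpos, hlin, hsum, hf']
    field_simp
    ring
  · rw [Gf_eq hfpos, hdiff, hsum, hep']
    field_simp
    ring
  · rw [detH, hGuu, Gff_eq hfpos, Guf_eq hu hfpos, Gfu_eq hu hfpos, hsum, hf', hep']
    field_simp
    ring
  · rw [hGuu]
    exact neg_ne_zero.mpr (by positivity)
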